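/- Let G = (V,E) be a strongly connected finite simple directed graph on n vertices and let t_sb denote the number of strong bridges of G. Then there exists an edge set E* ⊆ E with |E*| < (4 + 2·t_sb)·n such that G* = (V, E*) is strongly connected and the 2-edge blocks of G* are exactly the 2-edge blocks of G. -/

import Mathlib

variable {V : Type*}

/-- `p` is a simple directed path from `x` to `y` w.r.t. the edge relation `E`. -/
def IsDipath (E : V → V → Prop) (x y : V) (p : List V) : Prop :=
  List.Chain' E p ∧ p.head? = some x ∧ p.getLast? = some y ∧ p.Nodup

/-- The edges of a path, as the list of consecutive pairs. -/
def dipathEdges (p : List V) : List (V × V) := p.zip p.tail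

/-- There are two (distinct, internally vertex-disjoint) paths from `x` to `y`:
they share no vertices other than `x` and `y`. -/
def TwoVDP (E : V → V → Prop) (x y : V) : Prop :=
  ∃ p q : List V, IsDipath E x y p ∧ IsDipath E x y q ∧ p ≠ q ∧
    ∀ z, z ∈ p → z ∈ q → z = x ∨ z = y

/-- There are two edge-disjoint paths from `x` to `y`. -/
def TwoEDP (E : V → V → Prop) (x y : V) : Prop :=
  ∃ p q : List V, IsDipath E x y p ∧ IsDipath E x y q ∧
    ∀ e, e ∈ dipathEdges p → e ∉ dipathEdges q

/-- Reachability in a digraph. -/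
def DiReach (E : V → V → Prop) (x y : V) : Prop := Relation.ReflTransGen E x y

/-- `x` and `y` lie in the same strongly connected component. -/
def InSameSCC (E : V → V → Prop) (x y : V) : Prop := DiReach E x y ∧ DiReach E y x

/-- The digraph is strongly connected. -/
def IsStronglyConn (E : V → V → Prop) : Prop := ∀ x y, DiReach E x y

/-- Deleting a vertex `w` (and its incident edges). -/
def DelVertex (E : V → V → Prop) (w : V) : V → V → Prop :=
  fun a b => E a b ∧ a ≠ w ∧ b ≠ w

/-- `x ↔² y` : two vertex-disjoint paths in both directions. -/
def Rel2d (E : V → V → Prop) (x y : V) : Prop :=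
  x ≠ y ∧ TwoVDP E x y ∧ TwoVDP E y x

/-- `x ↔^{2s} y`. -/
def Rel2s (E : V → V → Prop) (x y : V) : Prop :=
  x ≠ y ∧ ∀ z, z ≠ x → z ≠ y → InSameSCC (DelVertex E z) x y

/-- `x ↔^{2e} y` : two edge-disjoint paths in both directions. -/
def Rel2e (E : V → V → Prop) (x y : V) : Prop :=
  x ≠ y ∧ TwoEDP E x y ∧ TwoEDP E y x

/-- A maximal vertex set of size ≥ `k` all of whose pairs of distinct elements
satisfy the relation `R` (e.g. a 2-directed/2-strong/2-edge block). -/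
def IsMaxBlock (R : V → V → Prop) (k : ℕ) (C : Set V) : Prop :=
  k ≤ C.ncard ∧ (∀ x ∈ C, ∀ y ∈ C, x ≠ y → R x y) ∧
    ∀ D : Set V, C ⊆ D → (∀ x ∈ D, ∀ y ∈ D, x ≠ y → R x y) → D = C

theorem rmono {V : Type*} {R S : V → V → Prop} {x y : V} (h : Relation.ReflTransGen R x y)
    (hs : ∀ a b, R a b → S a b) : Relation.ReflTransGen S x y := by
  induction h with
  | refl => exact .refl
  | tail _ h2 ih => exact ih.tail (hs _ _ h2)

open Classical in
/-- Net outflow of the edge set `F` at `v`. -/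
noncomputable def fdiv {V : Type*} (F : Finset (V × V)) (v : V) : ℤ :=
  ∑ p ∈ F, ((if p.1 = v then (1 : ℤ) else 0) - (if p.2 = v then (1 : ℤ) else 0))

open Classical in
/-- Indicator of a vertex. -/
noncomputable def vind {V : Type*} (x v : V) : ℤ := if x = v then 1 else 0

theorem exists_crossing {V : Type*} {R : V → V → Prop} {x y : V} (h : Relation.ReflTransGen R x y)
    (S : V → Prop) (hx : S x) (hy : ¬ S y) : ∃ a b, R a b ∧ S a ∧ ¬ S b := by
  induction h with
  | refl => exact absurd hx hy
  | tail h1 h2 ih =>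
    rename_i b c
    by_cases hb : S b
    · exact ⟨b, c, h2, hb, hy⟩
    · exact ih hb

theorem exists_dipath {V : Type*} {R : V → V → Prop} {x y : V} (h : Relation.ReflTransGen R x y) :
    ∃ p, IsDipath R x y p := by
  induction h using Relation.ReflTransGen.head_induction_on with
  | refl => exact ⟨[y], List.isChain_singleton y, by simp⟩
  | head h1 h2 ih =>
    rename_i a b
    obtain ⟨p, hc, hh, hl, hn⟩ := ih
    by_cases ha : a ∈ p
    · obtain ⟨s, t, rfl⟩ := List.append_of_mem ha
      refine ⟨a :: t, (List.isChain_append.1 hc).2.1, by simp, ?_, (List.nodup_append.1 hn).2.1⟩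
      simpa [List.getLast?_append] using hl
    · refine ⟨a :: p, ?_, by simp, ?_, by simp [ha, hn]⟩
      · refine List.isChain_cons.2 ⟨?_, hc⟩
        intro z hz
        rw [hh] at hz
        simp at hz
        subst hz; exact h1
      · cases p with
        | nil => simp at hh
        | cons c t => simpa [List.getLast?_cons_cons] using hl

theorem chain_iff_edges {V : Type*} (R : V → V → Prop) (p : List V) :
    List.IsChain R p ↔ ∀ e ∈ dipathEdges p, R e.1 e.2 := by
  induction p with
  | nil => simp [dipathEdges]
  | cons a t ih =>
    cases t with
    | nil => simp [dipathEdges]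
    | cons b u =>
      rw [List.isChain_cons_cons, ih]
      simp [dipathEdges]

theorem reach_of_chain {V : Type*} {R : V → V → Prop} {y : V} (p : List V) : ∀ x : V,
    List.IsChain R p → p.head? = some x → p.getLast? = some y → Relation.ReflTransGen R x y := by
  induction p with
  | nil => intro x _ h; simp at h
  | cons a t ih =>
    intro x hc hh hl
    simp at hh; subst hh
    cases t with
    | nil => simp at hl; subst hl; exact .refl
    | cons b u =>
      rw [List.isChain_cons_cons] at hc
      exact .head hc.1 (ih b hc.2 (by simp) (by simpa [List.getLast?_cons_cons] using hl))

theorem twoEDP_reach {V : Type*} {E : V → V → Prop} {x y : V} (h : TwoEDP E x y) (e : V × V) :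
    DiReach (fun a b => E a b ∧ (a, b) ≠ e) x y := by
  obtain ⟨p, q, hp, hq, hd⟩ := h
  have key : ∀ p, IsDipath E x y p → e ∉ dipathEdges p →
      DiReach (fun a b => E a b ∧ (a, b) ≠ e) x y := by
    intro p hp he
    refine reach_of_chain p x ?_ hp.2.1 hp.2.2.1
    rw [chain_iff_edges]
    intro f hf
    exact ⟨(chain_iff_edges E p).1 hp.1 f hf, fun h => he (h ▸ hf)⟩
  by_cases he : e ∈ dipathEdges p
  · exact key q hq (hd e he)
  · exact key p hp he

/-- Residual relation. -/
def Resid {V : Type*} (E : V → V → Prop) (F : Finset (V × V)) (a b : V) : Prop :=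
  (E a b ∧ (a, b) ∉ F) ∨ (b, a) ∈ F

theorem augment_path {V : Type*} (E : V → V → Prop) {y : V} (p : List V) :
    ∀ (x : V) (F : Finset (V × V)), (∀ e ∈ F, E e.1 e.2) → IsDipath (Resid E F) x y p →
    ∃ F' : Finset (V × V), (∀ e ∈ F', E e.1 e.2) ∧
      ∀ v, fdiv F' v = fdiv F v + vind x v - vind y v := by
  classical
  induction p with
  | nil => intro x F _ h; simp [IsDipath] at h
  | cons a t ih =>
    intro x F hF h
    obtain ⟨hc, hh, hl, hn⟩ := h
    simp at hh; subst hh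
    cases t with
    | nil => simp at hl; subst hl; exact ⟨F, hF, by simp⟩
    | cons b u =>
      have hc' := List.isChain_cons_cons.1 hc
      have hl' : (b :: u).getLast? = some y := by simpa [List.getLast?_cons_cons] using hl
      have hn' := List.nodup_cons.1 hn
      have step : ∀ F1 : Finset (V × V), (∀ e ∈ F1, E e.1 e.2) →
          (∀ c d, c ≠ a → d ≠ a → ((c, d) ∈ F1 ↔ (c, d) ∈ F)) →
          (∀ v, fdiv F1 v = fdiv F v + vind a v - vind b v) →
          ∃ F' : Finset (V × V), (∀ e ∈ F', E e.1 e.2) ∧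
            ∀ v, fdiv F' v = fdiv F v + vind a v - vind y v := by
        intro F1 h1 h2 h3
        have hch : List.IsChain (Resid E F1) (b :: u) := by
          refine (chain_iff_edges _ _).2 ?_
          intro e he
          have h4 := (chain_iff_edges _ _).1 hc'.2 e he
          have h5 : e.1 ∈ b :: u ∧ e.2 ∈ b :: u := by
            have := List.of_mem_zip (l₁ := b :: u) (l₂ := (b :: u).tail) (a := e.1) (b := e.2) he
            exact ⟨this.1, List.mem_of_mem_tail this.2⟩
          have h6 : e.1 ≠ a := fun h => hn'.1 (h ▸ h5.1)
          have h7 : e.2 ≠ a := fun h => hn'.1 (h ▸ h5.2)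
          unfold Resid at h4 ⊢
          rw [h2 _ _ h6 h7, h2 _ _ h7 h6]
          exact h4
        obtain ⟨F', hF', hd⟩ := ih b F1 h1 ⟨hch, by simp, hl', hn'.2⟩
        exact ⟨F', hF', fun v => by rw [hd, h3]; ring⟩
      rcases hc'.1 with ⟨h1, h2⟩ | h1
      · refine step (insert (a, b) F) ?_ ?_ ?_
        · intro e he
          rcases Finset.mem_insert.1 he with rfl | he
          · exact h1
          · exact hF e he
        · intro c d hc hd
          simp [hc]
        · intro v
          unfold fdiv vind
          rw [Finset.sum_insert h2]
          ring
      · refine step (F.erase (b, a)) ?_ ?_ ?_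
        · intro e he
          exact hF e (Finset.mem_of_mem_erase he)
        · intro c d hc hd
          simp [hd]
        · intro v
          unfold fdiv vind
          rw [← Finset.add_sum_erase F _ h1]
          ring

theorem sum_fdiv {V : Type*} (F : Finset (V × V)) (S : Finset V) [DecidableEq V] :
    ∑ v ∈ S, fdiv F v = ∑ p ∈ F, ((if p.1 ∈ S then (1 : ℤ) else 0) - (if p.2 ∈ S then (1 : ℤ) else 0)) := by
  unfold fdiv
  rw [Finset.sum_comm]
  refine Finset.sum_congr rfl fun p _ => ?_
  rw [Finset.sum_sub_distrib]
  congr 1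
  · convert Finset.sum_ite_eq S p.1 (fun _ => (1 : ℤ))
  · convert Finset.sum_ite_eq S p.2 (fun _ => (1 : ℤ))

theorem sum_vind {V : Type*} (x : V) (S : Finset V) [DecidableEq V] :
    ∑ v ∈ S, vind x v = if x ∈ S then 1 else 0 := by
  unfold vind
  convert Finset.sum_ite_eq S x (fun _ => (1 : ℤ))

theorem augment {V : Type*} [Fintype V] (E : V → V → Prop) {x y : V}
    (hr : ∀ e, DiReach (fun a b => E a b ∧ (a, b) ≠ e) x y) (k : ℤ) (hk : k ≤ 1)
    (F : Finset (V × V)) (hF : ∀ e ∈ F, E e.1 e.2)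
    (hd : ∀ v, fdiv F v = k * (vind x v - vind y v)) :
    ∃ F' : Finset (V × V), (∀ e ∈ F', E e.1 e.2) ∧
      ∀ v, fdiv F' v = (k + 1) * (vind x v - vind y v) := by
  classical
  by_cases h : Relation.ReflTransGen (Resid E F) x y
  · obtain ⟨p, hp⟩ := exists_dipath h
    obtain ⟨F', h1, h2⟩ := augment_path E p x F hF hp
    exact ⟨F', h1, fun v => by rw [h2, hd]; ring⟩
  · exfalso
    set S : Finset V := Finset.univ.filter (fun v => Relation.ReflTransGen (Resid E F) x v) with hS
    have mS : ∀ v, v ∈ S ↔ Relation.ReflTransGen (Resid E F) x v := by simp [hS]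
    have hx : x ∈ S := (mS x).2 .refl
    have hy : y ∉ S := fun h' => h ((mS y).1 h')
    have hsum : ∑ v ∈ S, fdiv F v = k := by
      simp_rw [hd]
      rw [← Finset.mul_sum, Finset.sum_sub_distrib, sum_vind, sum_vind]
      simp [hx, hy]
    rw [sum_fdiv] at hsum
    have hout : ∀ a b, E a b → a ∈ S → b ∉ S → (a, b) ∈ F := by
      intro a b hab ha hb
      by_contra hn
      exact hb ((mS b).2 (((mS a).1 ha).tail (Or.inl ⟨hab, hn⟩)))
    have hin : ∀ p ∈ F, p.2 ∈ S → p.1 ∈ S := by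
      intro p hp hb
      exact (mS _).2 (((mS _).1 hb).tail (Or.inr hp))
    obtain ⟨a, b, ⟨hab, -⟩, ha, hb⟩ := exists_crossing (hr (x, x)) (· ∈ S) hx hy
    obtain ⟨c, d, ⟨hcd, hne⟩, hc, hd'⟩ := exists_crossing (hr (a, b)) (· ∈ S) hx hy
    have hsub : ({(a, b), (c, d)} : Finset (V × V)) ⊆ F := by
      intro e he
      simp only [Finset.mem_insert, Finset.mem_singleton] at he
      rcases he with rfl | rfl
      · exact hout _ _ hab ha hb
      · exact hout _ _ hcd hc hd'
    have := Finset.sum_le_sum_of_subset_of_nonneg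
      (f := fun p : V × V => ((if p.1 ∈ S then (1 : ℤ) else 0) - (if p.2 ∈ S then (1 : ℤ) else 0))) hsub ?_
    · rw [Finset.sum_pair (Ne.symm hne), hsum] at this
      simp [ha, hb, hc, hd'] at this
      omega
    · intro p hp _
      have := hin p hp
      split_ifs <;> simp_all

theorem flow_reach {V : Type*} [Fintype V] {x y : V} (k : ℤ) (hk : 1 ≤ k)
    (F : Finset (V × V)) (hd : ∀ v, fdiv F v = k * (vind x v - vind y v)) :
    Relation.ReflTransGen (fun a b => (a, b) ∈ F) x y := by
  classical
  by_contra h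
  set S : Finset V := Finset.univ.filter (fun v => Relation.ReflTransGen (fun a b => (a, b) ∈ F) x v) with hS
  have mS : ∀ v, v ∈ S ↔ Relation.ReflTransGen (fun a b => (a, b) ∈ F) x v := by simp [hS]
  have hx : x ∈ S := (mS x).2 .refl
  have hy : y ∉ S := fun h' => h ((mS y).1 h')
  have hsum : ∑ v ∈ S, fdiv F v = k := by
    simp_rw [hd]
    rw [← Finset.mul_sum, Finset.sum_sub_distrib, sum_vind, sum_vind]
    simp [hx, hy]
  rw [sum_fdiv] at hsum
  have : ∑ p ∈ F, ((if p.1 ∈ S then (1 : ℤ) else 0) - (if p.2 ∈ S then (1 : ℤ) else 0)) ≤ 0 := by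
    refine Finset.sum_nonpos fun p hp => ?_
    have : p.1 ∈ S → p.2 ∈ S := fun h1 => (mS _).2 (((mS _).1 h1).tail hp)
    split_ifs <;> simp_all
  omega

theorem flow_remove {V : Type*} {y : V} (p : List V) :
    ∀ (x : V) (F : Finset (V × V)), IsDipath (fun a b => (a, b) ∈ F) x y p →
    ∃ F' : Finset (V × V), F' ⊆ F ∧ (∀ e ∈ dipathEdges p, e ∉ F') ∧
      ∀ v, fdiv F' v = fdiv F v - vind x v + vind y v := by
  classical
  induction p with
  | nil => intro x F h; simp [IsDipath] at h
  | cons a t ih =>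
    intro x F h
    obtain ⟨hc, hh, hl, hn⟩ := h
    simp at hh; subst hh
    cases t with
    | nil => simp at hl; subst hl; exact ⟨F, subset_rfl, by simp [dipathEdges], by simp⟩
    | cons b u =>
      have hc' := List.isChain_cons_cons.1 hc
      have hl' : (b :: u).getLast? = some y := by simpa [List.getLast?_cons_cons] using hl
      have hn' := List.nodup_cons.1 hn
      have hch : List.IsChain (fun c d => (c, d) ∈ F.erase (a, b)) (b :: u) := by
        refine (chain_iff_edges _ _).2 ?_
        intro e he
        have h4 := (chain_iff_edges _ _).1 hc'.2 e he
        have h5 := (List.of_mem_zip (l₁ := b :: u) (l₂ := (b :: u).tail) (a := e.1) (b := e.2) he).1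
        have h6 : e.1 ≠ a := fun h => hn'.1 (h ▸ h5)
        exact Finset.mem_erase.2 ⟨fun hh => h6 (congrArg Prod.fst hh), h4⟩
      obtain ⟨F', h1, h2, h3⟩ := ih b (F.erase (a, b)) ⟨hch, by simp, hl', hn'.2⟩
      · refine ⟨F', h1.trans (Finset.erase_subset _ _), ?_, ?_⟩
        · intro e he
          have : e = (a, b) ∨ e ∈ dipathEdges (b :: u) := by simpa [dipathEdges] using he
          rcases this with rfl | he
          · intro hh; simpa using h1 hh
          · exact h2 e he
        · intro v
          rw [h3]
          unfold fdiv vind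
          rw [← Finset.add_sum_erase F _ hc'.1]
          ring

theorem twoEDP_of_reach {V : Type*} [Fintype V] (E : V → V → Prop) {x y : V}
    (hr : ∀ e, DiReach (fun a b => E a b ∧ (a, b) ≠ e) x y) : TwoEDP E x y := by
  obtain ⟨F1, h1, d1⟩ := augment E hr 0 (by norm_num) ∅ (by simp) (by simp [fdiv])
  obtain ⟨F2, h2, d2⟩ := augment E hr (0 + 1) (by norm_num) F1 h1 d1
  obtain ⟨p, hp⟩ := exists_dipath (flow_reach _ (by norm_num) F2 d2)
  obtain ⟨F3, s3, e3, d3⟩ := flow_remove p x F2 hp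
  obtain ⟨q, hq⟩ := exists_dipath (flow_reach 1 (by norm_num) F3 (x := x) (y := y)
    (fun v => by rw [d3, d2]; ring))
  refine ⟨p, q, ⟨?_, hp.2⟩, ⟨?_, hq.2⟩, ?_⟩
  · exact hp.1.imp fun a b h => h2 _ h
  · exact hq.1.imp fun a b h => h2 _ (s3 h)
  · intro e he heq
    exact e3 e he ((chain_iff_edges _ _).1 hq.1 e heq)

/-- Reachability in exactly `n` steps. -/
def reachN {V : Type*} (R : V → V → Prop) : ℕ → V → V → Prop
  | 0, a, b => a = b
  | n + 1, a, b => ∃ c, reachN R n a c ∧ R c b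

theorem reachN_reach {V : Type*} {R : V → V → Prop} (n : ℕ) : ∀ {a b : V}, reachN R n a b →
    Relation.ReflTransGen R a b := by
  induction n with
  | zero => intro a b h; simp [reachN] at h; subst h; exact .refl
  | succ n ih => intro a b h; obtain ⟨c, h1, h2⟩ := h; exact (ih h1).tail h2

theorem reach_reachN {V : Type*} {R : V → V → Prop} {a b : V} (h : Relation.ReflTransGen R a b) :
    ∃ n, reachN R n a b := by
  induction h with
  | refl => exact ⟨0, rfl⟩
  | tail h1 h2 ih => obtain ⟨n, hn⟩ := ih; exact ⟨n + 1, _, hn, h2⟩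

theorem sparse_tree {V : Type*} [Fintype V] (R : V → V → Prop) (r : V → V)
    (h1 : ∀ v, Relation.ReflTransGen R (r v) v)
    (h2 : ∀ u v, R u v → Relation.ReflTransGen R (r v) u → r u = r v) :
    ∃ K : Finset (V × V), K.card ≤ Fintype.card V ∧ (∀ e ∈ K, R e.1 e.2) ∧
      ∀ v, Relation.ReflTransGen (fun a b => (a, b) ∈ K) (r v) v := by
  classical
  have hex : ∀ v, ∃ n, reachN R n (r v) v := fun v => reach_reachN (h1 v)
  let d : V → ℕ := fun v => Nat.find (hex v)
  have hd : ∀ v, reachN R (d v) (r v) v := fun v => Nat.find_spec (hex v)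
  have hpar : ∀ v, ∃ u, r v = v ∨ (R u v ∧ r u = r v ∧ d u < d v) := by
    intro v
    have := hd v
    rcases hdv : d v with _ | n
    · rw [hdv] at this
      exact ⟨v, Or.inl this⟩
    · rw [hdv] at this
      obtain ⟨u, hu, huv⟩ := this
      have hr := h2 u v huv (reachN_reach n hu)
      refine ⟨u, Or.inr ⟨huv, hr, ?_⟩⟩
      have : d u ≤ n := Nat.find_min' (hex u) (hr ▸ hu)
      omega
  choose par hpar using hpar
  refine ⟨(Finset.univ.filter (fun v => r v ≠ v)).image (fun v => (par v, v)), ?_, ?_, ?_⟩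
  · exact Finset.card_image_le.trans (Finset.card_le_univ _)
  · intro e he
    simp only [Finset.mem_image, Finset.mem_filter, Finset.mem_univ, true_and] at he
    obtain ⟨v, hv, rfl⟩ := he
    exact ((hpar v).resolve_left hv).1
  · have : ∀ n v, d v = n → Relation.ReflTransGen (fun a b => (a, b) ∈
        (Finset.univ.filter (fun v => r v ≠ v)).image (fun v => (par v, v))) (r v) v := by
      intro n
      induction n using Nat.strong_induction_on with
      | _ n ih =>
        intro v hv
        by_cases hrv : r v = v
        · rw [hrv]
        · obtain ⟨h3, h4, h5⟩ := (hpar v).resolve_left hrv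
          have := ih (d (par v)) (by omega) _ rfl
          rw [h4] at this
          refine this.tail ?_
          simp only [Finset.mem_image, Finset.mem_filter, Finset.mem_univ, true_and]
          exact ⟨v, hrv, rfl⟩
    exact fun v => this _ v rfl

theorem reach_swap {V : Type*} {R : V → V → Prop} {a b : V} :
    Relation.ReflTransGen (fun u v => R v u) a b ↔ Relation.ReflTransGen R b a :=
  Relation.reflTransGen_swap (r := R)

theorem sparse_scc {V : Type*} [Fintype V] (R : V → V → Prop) :
    ∃ K : Finset (V × V), K.card ≤ 2 * Fintype.card V ∧ (∀ e ∈ K, R e.1 e.2) ∧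
      ∀ x y, InSameSCC R x y → InSameSCC (fun a b => (a, b) ∈ K) x y := by
  classical
  let st : Setoid V := ⟨InSameSCC R, fun x => ⟨.refl, .refl⟩, fun h => ⟨h.2, h.1⟩,
    fun h1 h2 => ⟨h1.1.trans h2.1, h2.2.trans h1.2⟩⟩
  let r : V → V := fun v => (Quotient.mk st v).out
  have hr : ∀ v, InSameSCC R (r v) v := fun v => Quotient.exact (Quotient.out_eq (Quotient.mk st v))
  have hr2 : ∀ u v, InSameSCC R u v → r u = r v := by
    intro u v h
    have : Quotient.mk st u = Quotient.mk st v := Quotient.sound h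
    simp only [r, this]
  obtain ⟨K1, c1, s1, t1⟩ := sparse_tree R r (fun v => (hr v).1) (by
    intro u v huv h
    exact hr2 _ _ ⟨.single huv, (hr v).2.trans h⟩)
  obtain ⟨K2, c2, s2, t2⟩ := sparse_tree (fun a b => R b a) r (fun v => reach_swap.2 (hr v).2) (by
    intro u v huv h
    exact hr2 _ _ ⟨(reach_swap.1 h).trans (hr v).1, .single huv⟩)
  refine ⟨K1 ∪ K2.image Prod.swap, ?_, ?_, ?_⟩
  · have := Finset.card_union_le K1 (K2.image Prod.swap)
    have := Finset.card_image_le (s := K2) (f := Prod.swap)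
    omega
  · intro e he
    rcases Finset.mem_union.1 he with he | he
    · exact s1 e he
    · obtain ⟨f, hf, rfl⟩ := Finset.mem_image.1 he
      exact s2 f hf
  · have key : ∀ x y, InSameSCC R x y →
        DiReach (fun a b => (a, b) ∈ K1 ∪ K2.image Prod.swap) x y := by
      intro x y h
      have h3 := t2 x
      have h4 := t1 y
      rw [← hr2 x y h] at h4
      have h3' : Relation.ReflTransGen (fun a b => (b, a) ∈ K2) x (r x) := reach_swap.1 h3
      refine Relation.ReflTransGen.trans (rmono h3' ?_) (rmono h4 ?_)
      · intro a b hab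
        exact Finset.mem_union_right _ (Finset.mem_image.2 ⟨_, hab, rfl⟩)
      · intro a b hab
        exact Finset.mem_union_left _ hab
    exact fun x y h => ⟨key x y h, key y x ⟨h.2, h.1⟩⟩

open Classical in
/-- Weight of edges entering `S`. -/
noncomputable def din {V : Type*} [Fintype V] (m : V × V → ℕ) (S : Finset V) : ℕ :=
  ∑ p : V × V, if p.1 ∉ S ∧ p.2 ∈ S then m p else 0

theorem din_submod {V : Type*} [Fintype V] [DecidableEq V] (m : V × V → ℕ) (X Y : Finset V) :
    din m (X ∩ Y) + din m (X ∪ Y) ≤ din m X + din m Y := by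
  unfold din
  rw [← Finset.sum_add_distrib, ← Finset.sum_add_distrib]
  refine Finset.sum_le_sum fun p _ => ?_
  simp only [Finset.mem_inter, Finset.mem_union]
  by_cases h1 : p.1 ∈ X <;> by_cases h2 : p.2 ∈ X <;> by_cases h3 : p.1 ∈ Y <;>
    by_cases h4 : p.2 ∈ Y <;> simp [h1, h2, h3, h4]

theorem sparse_out {V : Type*} [Fintype V] (R : V → V → Prop) (s : V) (B : Set (V × V))
    (hB : ∀ e ∈ B, R e.1 e.2)
    (h : ∀ e ∉ B, ∀ v, DiReach (fun a b => R a b ∧ (a, b) ≠ e) s v) (hss : (s, s) ∉ B) :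
    ∃ H : Finset (V × V), H.card + 2 ≤ 2 * Fintype.card V ∧ (∀ e ∈ H, R e.1 e.2) ∧
      ∀ e ∉ B, ∀ v, DiReach (fun a b => (a, b) ∈ H ∧ (a, b) ≠ e) s v := by
  classical
  let w : V × V → ℕ := fun e => if e ∈ B then 2 else if R e.1 e.2 then 1 else 0
  let Feas : (V × V → ℕ) → Prop := fun m => (∀ e, m e ≤ w e) ∧
    ∀ S : Finset V, S.Nonempty → s ∉ S → 2 ≤ din m S
  have hw : Feas w := by
    refine ⟨fun e => le_rfl, ?_⟩
    rintro S ⟨v, hv⟩ hs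
    obtain ⟨a, b, ⟨hab, -⟩, ha, hb⟩ := exists_crossing (h _ hss v) (· ∉ S) hs (by simpa using hv)
    simp only [not_not] at hb
    unfold din
    by_cases habB : (a, b) ∈ B
    · have := Finset.single_le_sum (f := fun p : V × V => if p.1 ∉ S ∧ p.2 ∈ S then w p else 0)
        (fun _ _ => Nat.zero_le _) (Finset.mem_univ (a, b))
      simp only [ha, hb, not_false_eq_true, and_self, if_true] at this
      have h2 : w (a, b) = 2 := by simp [w, habB]
      omega
    · obtain ⟨c, d, ⟨hcd, hne⟩, hc, hd⟩ := exists_crossing (h _ habB v) (· ∉ S) hs (by simpa using hv)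
      simp only [not_not] at hd
      have := Finset.sum_le_sum_of_subset (f := fun p : V × V => if p.1 ∉ S ∧ p.2 ∈ S then w p else 0)
        (Finset.subset_univ ({(a, b), (c, d)} : Finset (V × V)))
      rw [Finset.sum_pair (Ne.symm hne)] at this
      simp only [ha, hb, hc, hd, not_false_eq_true, and_self, if_true] at this
      have h2 : 1 ≤ w (a, b) := by simp only [w]; split_ifs <;> simp_all
      have h3 : 1 ≤ w (c, d) := by simp only [w]; split_ifs <;> simp_all
      omega
  have hexn : ∃ n, ∃ m, Feas m ∧ ∑ e, m e = n := ⟨_, w, hw, rfl⟩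
  obtain ⟨m, hm, hmn⟩ := Nat.find_spec hexn
  have hmin : ∀ m', Feas m' → ∑ e, m e ≤ ∑ e, m' e := by
    intro m' hm'
    rw [hmn]
    exact Nat.find_min' hexn ⟨m', hm', rfl⟩
  have htight : ∀ u v, 0 < m (u, v) → ∃ X : Finset V, s ∉ X ∧ v ∈ X ∧ u ∉ X ∧ din m X = 2 := by
    intro u v huv
    let m' : V × V → ℕ := Function.update m (u, v) (m (u, v) - 1)
    have hlt : ∑ e, m' e < ∑ e, m e := by
      refine Finset.sum_lt_sum ?_ ⟨(u, v), Finset.mem_univ _, ?_⟩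
      · intro e _
        by_cases he : e = (u, v)
        · subst he; simp [m']
        · simp [m', he]
      · simp only [m', Function.update_self]; omega
    have hnf : ¬ Feas m' := fun hf => absurd (hmin m' hf) (by omega)
    have hle : ∀ e, m' e ≤ w e := by
      intro e
      by_cases he : e = (u, v)
      · subst he
        have := hm.1 (u, v)
        simp only [m', Function.update_self]; omega
      · simpa [m', he] using hm.1 e
    have : ∃ S : Finset V, S.Nonempty ∧ s ∉ S ∧ din m' S < 2 := by
      by_contra hcon
      push Not at hcon
      exact hnf ⟨hle, hcon⟩
    obtain ⟨S, hS, hs, hlt2⟩ := this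
    have h2 := hm.2 S hS hs
    have hdin : din m S = din m' S + (if u ∉ S ∧ v ∈ S then 1 else 0) := by
      unfold din
      rw [← Finset.add_sum_erase _ _ (Finset.mem_univ (u, v)),
        ← Finset.add_sum_erase _ (fun p : V × V => if p.1 ∉ S ∧ p.2 ∈ S then m' p else 0)
          (Finset.mem_univ (u, v))]
      have : ∑ x ∈ Finset.univ.erase (u, v), (if x.1 ∉ S ∧ x.2 ∈ S then m x else 0)
          = ∑ x ∈ Finset.univ.erase (u, v), (if x.1 ∉ S ∧ x.2 ∈ S then m' x else 0) := by
        refine Finset.sum_congr rfl fun x hx => ?_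
        have := Finset.ne_of_mem_erase hx
        simp [m', this]
      rw [this]
      simp only [m', Function.update_self]
      split_ifs <;> omega
    by_cases hc : u ∉ S ∧ v ∈ S
    · rw [if_pos hc] at hdin
      exact ⟨S, hs, hc.2, hc.1, by omega⟩
    · rw [if_neg hc] at hdin
      omega
  have hdeg : ∀ v, ∑ u, m (u, v) ≤ if v = s then 0 else 2 := by
    intro v
    by_cases hpos : ∃ u, 0 < m (u, v)
    · obtain ⟨u0, hu0⟩ := hpos
      obtain ⟨X0, hX0⟩ := htight u0 v hu0
      have hvs : v ≠ s := fun hh => hX0.1 (hh ▸ hX0.2.1)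
      rw [if_neg hvs]
      have hne : (Finset.univ.filter (fun X : Finset V => s ∉ X ∧ v ∈ X ∧ din m X = 2)).Nonempty :=
        ⟨X0, by simp [hX0]⟩
      obtain ⟨X, hX, hXmin⟩ := Finset.exists_min_image _ Finset.card hne
      simp only [Finset.mem_filter, Finset.mem_univ, true_and] at hX hXmin
      have hent : ∀ u, 0 < m (u, v) → u ∉ X := by
        intro u hu huX
        obtain ⟨Y, hY1, hY2, hY3, hY4⟩ := htight u v hu
        have hsub := din_submod m X Y
        have h1 := hm.2 (X ∩ Y) ⟨v, by simp [hX, hY2]⟩ (by simp [hX.1])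
        have h2 := hm.2 (X ∪ Y) ⟨v, by simp [hX]⟩ (by simp [hX.1, hY1])
        have h3 := hXmin (X ∩ Y) ⟨by simp [hX.1], by simp [hX, hY2], by omega⟩
        have h4 := Finset.eq_of_subset_of_card_le (Finset.inter_subset_left) h3
        rw [← h4] at huX
        exact hY3 (Finset.mem_inter.1 huX).2
      rw [← hX.2.2]
      unfold din
      rw [Fintype.sum_prod_type_right]
      refine le_trans ?_ (Finset.single_le_sum (fun _ _ => Nat.zero_le _) (Finset.mem_univ v))
      refine Finset.sum_le_sum fun u _ => ?_
      rcases Nat.eq_zero_or_pos (m (u, v)) with h0 | h0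
      · simp [h0]
      · simp [hent u h0, hX.2.1]
    · push Not at hpos
      rw [Finset.sum_eq_zero (fun u _ => Nat.le_zero.1 (hpos u))]
      exact Nat.zero_le _
  refine ⟨Finset.univ.filter (fun e => 0 < m e), ?_, ?_, ?_⟩
  · have h1 : (Finset.univ.filter (fun e => 0 < m e)).card ≤ ∑ e, m e := by
      rw [Finset.card_filter]
      exact Finset.sum_le_sum fun e _ => by split_ifs <;> omega
    have h2 : ∑ e, m e ≤ ∑ v : V, if v = s then 0 else 2 := by
      rw [Fintype.sum_prod_type_right]
      exact Finset.sum_le_sum fun v _ => hdeg v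
    have h3 : (∑ v : V, if v = s then 0 else 2) + 2 = 2 * Fintype.card V := by
      have : (∑ v : V, if v = s then 0 else 2) + (∑ v : V, if v = s then 2 else 0)
          = ∑ v : V, 2 := by
        rw [← Finset.sum_add_distrib]
        exact Finset.sum_congr rfl fun v _ => by split_ifs <;> rfl
      simp only [Finset.sum_ite_eq', Finset.mem_univ, if_true, Finset.sum_const, Finset.card_univ,
        smul_eq_mul] at this
      omega
    omega
  · intro e he
    simp only [Finset.mem_filter, Finset.mem_univ, true_and] at he
    have h1 := hm.1 e
    by_cases heB : e ∈ B
    · exact hB e heB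
    · by_contra hR
      simp only [w, heB, hR, if_false] at h1
      omega
  · intro e he v
    by_contra hv
    set S : Finset V := Finset.univ.filter (fun v => ¬ DiReach (fun a b => (a, b) ∈
      Finset.univ.filter (fun e => 0 < m e) ∧ (a, b) ≠ e) s v) with hS
    have mS : ∀ v, v ∉ S ↔ DiReach (fun a b => (a, b) ∈
      Finset.univ.filter (fun e => 0 < m e) ∧ (a, b) ≠ e) s v := by
      intro v; rw [hS]; simp
    have h1 := hm.2 S ⟨v, by_contra fun hh => hv ((mS v).1 hh)⟩ ((mS s).2 .refl)
    have h2 : din m S ≤ m e := by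
      unfold din
      rw [Finset.sum_eq_single e]
      · split_ifs <;> omega
      · rintro ⟨a, b⟩ - hne
        split_ifs with hc
        · by_contra hm0
          refine (mS b).2 (((mS a).1 hc.1).tail ⟨?_, hne⟩) hc.2
          simp only [Finset.mem_filter, Finset.mem_univ, true_and]
          exact Nat.pos_of_ne_zero hm0
        · rfl
      · simp
    have h3 := hm.1 e
    have h4 : w e ≤ 1 := by simp only [w, he, if_false]; split_ifs <;> omega
    omega

/-- a strongly connected finite simple digraph on `n ≥ 1` vertices
with `t_sb` strong bridges has a strongly connected spanning subgraph with fewer than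
`(4 + 2 t_sb) n` edges and exactly the same 2-edge blocks. -/
theorem stmt16 {V : Type*} [Fintype V] [Nonempty V] (E : V → V → Prop)
    (hirr : ∀ v, ¬ E v v) (hsc : IsStronglyConn E) :
    ∃ E' : Set (V × V), E' ⊆ {e : V × V | E e.1 e.2} ∧
      E'.ncard <
        (4 + 2 * {e : V × V | E e.1 e.2 ∧
            ¬ IsStronglyConn (fun a b : V => E a b ∧ (a, b) ≠ e)}.ncard) *
          Fintype.card V ∧
      IsStronglyConn (fun a b : V => (a, b) ∈ E') ∧
      ∀ C : Set V,
        IsMaxBlock (Rel2e (fun a b : V => (a, b) ∈ E')) 2 C ↔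
          IsMaxBlock (Rel2e E) 2 C := by
  classical
  set Bs : Set (V × V) := {e : V × V | E e.1 e.2 ∧
            ¬ IsStronglyConn (fun a b : V => E a b ∧ (a, b) ≠ e)} with hBs
  have hBn : ∀ e ∉ Bs, IsStronglyConn (fun a b : V => E a b ∧ (a, b) ≠ e) := by
    intro e he
    by_cases hE : E e.1 e.2
    · by_contra hc
      exact he ⟨hE, hc⟩
    · intro x y
      refine rmono (hsc x y) fun a b hab => ⟨hab, ?_⟩
      rintro rfl
      exact hE hab
  obtain ⟨s⟩ := ‹Nonempty V›
  have hss : (s, s) ∉ Bs := fun h => hirr s h.1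
  obtain ⟨H1, c1, s1, t1⟩ := sparse_out E s Bs (fun e he => he.1) (fun e he v => hBn e he s v) hss
  obtain ⟨H2, c2, s2, t2⟩ := sparse_out (fun a b => E b a) s (Prod.swap ⁻¹' Bs)
    (fun e he => he.1) (by
      intro e he v
      have := hBn e.swap he v s
      refine rmono (reach_swap.2 this) ?_
      rintro a b ⟨h1, h2⟩
      exact ⟨h1, fun hh => h2 (by rw [← hh]; rfl)⟩) hss
  have hK := fun e : V × V => sparse_scc (fun a b : V => E a b ∧ (a, b) ≠ e)
  choose K cK sK tK using hK
  have hfin : Bs.Finite := Set.toFinite _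
  let E' : Finset (V × V) := (H1 ∪ H2.image Prod.swap) ∪ hfin.toFinset.biUnion K
  have hsub : ∀ e ∈ E', E e.1 e.2 := by
    intro e he
    simp only [E', Finset.mem_union, Finset.mem_image, Finset.mem_biUnion] at he
    rcases he with (he | ⟨f, hf, rfl⟩) | ⟨f, _, hf⟩
    · exact s1 e he
    · exact s2 f hf
    · exact (sK f e hf).1
  have hconn : ∀ e ∉ Bs, IsStronglyConn (fun a b : V => (a, b) ∈ E' ∧ (a, b) ≠ e) := by
    intro e he x y
    have h1 : DiReach (fun a b : V => (a, b) ∈ E' ∧ (a, b) ≠ e) s y := by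
      refine rmono (t1 e he y) ?_
      rintro a b ⟨h1, h2⟩
      exact ⟨by simp [E', h1], h2⟩
    have h2 : DiReach (fun a b : V => (a, b) ∈ E' ∧ (a, b) ≠ e) x s := by
      refine reach_swap.1 (rmono (t2 e.swap (by simpa using he) x) ?_)
      rintro a b ⟨h1, h2⟩
      refine ⟨?_, fun hh => h2 (by rw [← hh]; rfl)⟩
      exact Finset.mem_union_left _ (Finset.mem_union_right _ (Finset.mem_image.2 ⟨_, h1, rfl⟩))
    exact h2.trans h1
  have hscc : ∀ x y, (∀ e, InSameSCC (fun a b => E a b ∧ (a, b) ≠ e) x y) →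
      ∀ e, InSameSCC (fun a b => (a, b) ∈ E' ∧ (a, b) ≠ e) x y := by
    intro x y h e
    by_cases he : e ∈ Bs
    · have hmono : ∀ a b, (a, b) ∈ K e → (a, b) ∈ E' ∧ (a, b) ≠ e := by
        intro a b hab
        refine ⟨Finset.mem_union_right _ (Finset.mem_biUnion.2 ⟨e, hfin.mem_toFinset.2 he, hab⟩), ?_⟩
        exact (sK e _ hab).2
      have := tK e x y (h e)
      exact ⟨rmono this.1 hmono, rmono this.2 hmono⟩
    · exact ⟨hconn e he x y, hconn e he y x⟩
  refine ⟨(E' : Set (V × V)), fun e he => hsub e he, ?_, ?_, ?_⟩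
  · rw [Set.ncard_coe_finset, Set.ncard_eq_toFinset_card _ hfin]
    have a1 := Finset.card_union_le (H1 ∪ H2.image Prod.swap) (hfin.toFinset.biUnion K)
    have a2 := Finset.card_union_le H1 (H2.image Prod.swap)
    have a3 := Finset.card_image_le (s := H2) (f := Prod.swap)
    have a4 := Finset.card_biUnion_le_card_mul hfin.toFinset K _ (fun e _ => cK e)
    have a5 : (4 + 2 * hfin.toFinset.card) * Fintype.card V =
      4 * Fintype.card V + hfin.toFinset.card * (2 * Fintype.card V) := by ring
    rw [a5]
    change E'.card ≤ _ at a1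
    omega
  · intro x y
    exact rmono (hconn _ hss x y) fun a b h => h.1
  · have hrel : Rel2e (fun a b : V => (a, b) ∈ (E' : Set (V × V))) = Rel2e E := by
      funext x y
      refine propext ⟨?_, ?_⟩
      · rintro ⟨h1, h2, h3⟩
        have hm : ∀ x y, TwoEDP (fun a b : V => (a, b) ∈ (E' : Set (V × V))) x y → TwoEDP E x y := by
          rintro x y ⟨p, q, hp, hq, hd⟩
          exact ⟨p, q, ⟨hp.1.imp fun a b h => hsub _ h, hp.2⟩,
            ⟨hq.1.imp fun a b h => hsub _ h, hq.2⟩, hd⟩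
        exact ⟨h1, hm _ _ h2, hm _ _ h3⟩
      · rintro ⟨h1, h2, h3⟩
        have := hscc x y fun e => ⟨twoEDP_reach h2 e, twoEDP_reach h3 e⟩
        exact ⟨h1, twoEDP_of_reach _ fun e => (this e).1, twoEDP_of_reach _ fun e => (this e).2⟩
    intro C
    rw [hrel]
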